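/- arXiv:2212.00598 — 2 statements merged into one kernel-verified Lean document; each statement's English description precedes it below -/
import Mathlib

section
/- Let f₁,…,f_r, g₁,…,g_s ∈ ℝ[x₁,…,xₙ], let K = {x ∈ ℝⁿ : fᵢ(x) ≥ 0 for i = 1,…,r and gⱼ(x) = 0 for j = 1,…,s}, and let M_S = {s₀ + Σ_{i=1}^r sᵢ·fᵢ + Σ_{j=1}^s pⱼ·gⱼ : s₀,…,s_r SOS, p₁,…,p_s ∈ ℝ[x₁,…,xₙ]}. Assume M_S is Archimedean, i.e. there exists an integer C ≥ 1 with C − Σ_{i=1}^n xᵢ² ∈ M_S. If q ∈ ℝ[x₁,…,xₙ] satisfies q(x) > 0 for all x ∈ K, then q ∈ M_S. -/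
/-- A polynomial is a sum of squares. -/
def IsSOS {n : ℕ} (s : MvPolynomial (Fin n) ℝ) : Prop :=
  ∃ (k : ℕ) (p : Fin k → MvPolynomial (Fin n) ℝ), s = ∑ i, (p i) ^ 2

/-- Membership in the quadratic module generated by inequalities `f₁,…,f_r` and
equations `g₁,…,g_s`: `q = s₀ + ∑ i sᵢ fᵢ + ∑ j pⱼ gⱼ` with `s₀,…,s_r` SOS. -/
def InQuadraticModule {n r s : ℕ} (f : Fin r → MvPolynomial (Fin n) ℝ)
    (g : Fin s → MvPolynomial (Fin n) ℝ) (q : MvPolynomial (Fin n) ℝ) : Prop :=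
  ∃ (s₀ : MvPolynomial (Fin n) ℝ) (si : Fin r → MvPolynomial (Fin n) ℝ)
    (p : Fin s → MvPolynomial (Fin n) ℝ),
    IsSOS s₀ ∧ (∀ i, IsSOS (si i)) ∧
    q = s₀ + ∑ i, si i * f i + ∑ j, p j * g j

open MvPolynomial in
/-- Quadratic module. -/
structure IsQM {n : ℕ} (T : Set (MvPolynomial (Fin n) ℝ)) : Prop where
  one : 1 ∈ T
  add : ∀ a b, a ∈ T → b ∈ T → a + b ∈ T
  sq : ∀ a t, t ∈ T → a ^ 2 * t ∈ T

namespace PutinarAux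
open MvPolynomial

variable {n : ℕ}

theorem sos_zero : IsSOS (0 : MvPolynomial (Fin n) ℝ) := ⟨0, fun _ => 0, by simp⟩

theorem sos_sq (a : MvPolynomial (Fin n) ℝ) : IsSOS (a ^ 2) := ⟨1, fun _ => a, by simp⟩

theorem sos_add {a b : MvPolynomial (Fin n) ℝ} (ha : IsSOS a) (hb : IsSOS b) :
    IsSOS (a + b) := by
  obtain ⟨k, p, rfl⟩ := ha
  obtain ⟨l, q, rfl⟩ := hb
  exact ⟨k + l, Fin.append p q, by simp [Fin.sum_univ_add]⟩

theorem sos_sq_mul (a : MvPolynomial (Fin n) ℝ) {b : MvPolynomial (Fin n) ℝ} (hb : IsSOS b) :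
    IsSOS (a ^ 2 * b) := by
  obtain ⟨l, q, rfl⟩ := hb
  exact ⟨l, fun i => a * q i, by simp [Finset.mul_sum, mul_pow]⟩

theorem sq_mem {T : Set (MvPolynomial (Fin n) ℝ)} (h : IsQM T) (a : MvPolynomial (Fin n) ℝ) :
    a ^ 2 ∈ T := by simpa using h.sq a 1 h.one

theorem zero_mem {T : Set (MvPolynomial (Fin n) ℝ)} (h : IsQM T) : 0 ∈ T := by
  simpa using sq_mem h 0

theorem smul_mem {T : Set (MvPolynomial (Fin n) ℝ)} (h : IsQM T) {c : ℝ} (hc : 0 ≤ c)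
    {t : MvPolynomial (Fin n) ℝ} (ht : t ∈ T) : C c * t ∈ T := by
  have := h.sq (C (Real.sqrt c)) t ht
  rwa [← map_pow, Real.sq_sqrt hc] at this

theorem const_mem {T : Set (MvPolynomial (Fin n) ℝ)} (h : IsQM T) {c : ℝ} (hc : 0 ≤ c) :
    C c ∈ T := by simpa using smul_mem h hc h.one

theorem sos_mul {T : Set (MvPolynomial (Fin n) ℝ)} (h : IsQM T)
    {s t : MvPolynomial (Fin n) ℝ} (hs : IsSOS s) (ht : t ∈ T) : s * t ∈ T := by
  obtain ⟨k, p, rfl⟩ := hs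
  rw [Finset.sum_mul]
  exact Finset.sum_induction _ (· ∈ T) h.add (zero_mem h) (fun i _ => h.sq _ _ ht)

theorem sos_mem {T : Set (MvPolynomial (Fin n) ℝ)} (h : IsQM T)
    {s : MvPolynomial (Fin n) ℝ} (hs : IsSOS s) : s ∈ T := by
  simpa using sos_mul h hs h.one

theorem sum_mem {T : Set (MvPolynomial (Fin n) ℝ)} (h : IsQM T) {ι : Type*} (S : Finset ι)
    (u : ι → MvPolynomial (Fin n) ℝ) (hu : ∀ i ∈ S, u i ∈ T) : ∑ i ∈ S, u i ∈ T :=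
  Finset.sum_induction _ (· ∈ T) h.add (zero_mem h) hu

/-- two-sided bound -/
def Bd (T : Set (MvPolynomial (Fin n) ℝ)) (c : ℝ) (a : MvPolynomial (Fin n) ℝ) : Prop :=
  C c + a ∈ T ∧ C c - a ∈ T

theorem Bd.neg {T : Set (MvPolynomial (Fin n) ℝ)} {c : ℝ}
    {a : MvPolynomial (Fin n) ℝ} (ha : Bd T c a) : Bd T c (-a) :=
  ⟨by simpa [sub_eq_add_neg] using ha.2, by simpa using ha.1⟩

theorem Bd.add {T : Set (MvPolynomial (Fin n) ℝ)} (h : IsQM T) {c d : ℝ}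
    {a b : MvPolynomial (Fin n) ℝ} (ha : Bd T c a) (hb : Bd T d b) : Bd T (c + d) (a + b) := by
  constructor
  · convert h.add _ _ ha.1 hb.1 using 1; rw [C_add]; ring
  · convert h.add _ _ ha.2 hb.2 using 1; rw [C_add]; ring

theorem Bd.smul_pos {T : Set (MvPolynomial (Fin n) ℝ)} (h : IsQM T) {c r : ℝ} (hr : 0 ≤ r)
    {a : MvPolynomial (Fin n) ℝ} (ha : Bd T c a) : Bd T (r * c) (C r * a) := by
  constructor
  · convert smul_mem h hr ha.1 using 1; rw [C_mul]; ring
  · convert smul_mem h hr ha.2 using 1; rw [C_mul]; ring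

theorem Bd.smul {T : Set (MvPolynomial (Fin n) ℝ)} (h : IsQM T) {c r : ℝ}
    {a : MvPolynomial (Fin n) ℝ} (ha : Bd T c a) : Bd T (|r| * c) (C r * a) := by
  rcases abs_cases r with ⟨h1, h2⟩ | ⟨h1, h2⟩
  · rw [h1]; exact ha.smul_pos h h2
  · rw [h1]
    have := (ha.smul_pos h (r := -r) (by linarith)).neg
    simpa using this

theorem Bd.sq {T : Set (MvPolynomial (Fin n) ℝ)} (h : IsQM T) {c : ℝ} (hc : 0 < c)
    {a : MvPolynomial (Fin n) ℝ} (ha : Bd T c a) : Bd T (c ^ 2) (a ^ 2) := by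
  constructor
  · exact h.add _ _ (const_mem h (by positivity)) (sq_mem h a)
  · have h1 := h.add _ _ (h.sq (C c - a) _ ha.1) (h.sq (C c + a) _ ha.2)
    have h2 := smul_mem h (c := 1 / (2 * c)) (by positivity) h1
    have e : (C (1 / (2 * c)) * C (2 * c) : MvPolynomial (Fin n) ℝ) = 1 := by
      rw [← C_mul, one_div_mul_cancel (by positivity), C_1]
    have e2 : (C (2 * c) : MvPolynomial (Fin n) ℝ) = 2 * C c := by
      rw [C_mul, show (C (2:ℝ) : MvPolynomial (Fin n) ℝ) = 2 from map_ofNat _ 2]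
    rw [e2] at e
    convert h2 using 1
    rw [C_pow]
    linear_combination (-(C c ^ 2 - a ^ 2)) * e

theorem Bd.mul {T : Set (MvPolynomial (Fin n) ℝ)} (h : IsQM T) {c d : ℝ} (hc : 0 < c)
    (hd : 0 < d) {a b : MvPolynomial (Fin n) ℝ} (ha : Bd T c a) (hb : Bd T d b) :
    Bd T ((c + d) ^ 2 / 2) (a * b) := by
  have h1 := (ha.add h hb).sq h (by positivity)
  have h2 := (ha.add h hb.neg).sq h (by positivity)
  have h3 := (h1.add h h2.neg).smul_pos h (r := 1 / 4) (by norm_num)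
  have e : (C (1 / 4) * 4 : MvPolynomial (Fin n) ℝ) = 1 := by
    have : (4 : MvPolynomial (Fin n) ℝ) = C 4 := (map_ofNat C 4).symm
    rw [this, ← C_mul]; norm_num
  convert h3 using 1
  · ring
  · linear_combination (-(a * b)) * e

/-- Archimedean. -/
def Arch (T : Set (MvPolynomial (Fin n) ℝ)) : Prop := ∀ a, ∃ c : ℝ, 0 < c ∧ Bd T c a

theorem arch_of {T : Set (MvPolynomial (Fin n) ℝ)} (h : IsQM T) {N : ℕ}
    (hN : (N : MvPolynomial (Fin n) ℝ) - ∑ i, (X i) ^ 2 ∈ T) : Arch T := by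
  have hX : ∀ i : Fin n, Bd T (N + 1 / 4) (X i : MvPolynomial (Fin n) ℝ) := by
    intro i
    have h1 : (N : MvPolynomial (Fin n) ℝ) - X i ^ 2 ∈ T := by
      have := h.add _ _ hN (sum_mem h (Finset.univ.erase i) (fun j => (X j) ^ 2)
        (fun j _ => sq_mem h _))
      convert this using 1
      rw [← Finset.add_sum_erase Finset.univ _ (Finset.mem_univ i)]
      ring
    have e : (C (1 / 2) * 2 : MvPolynomial (Fin n) ℝ) = 1 := by
      have : (2 : MvPolynomial (Fin n) ℝ) = C 2 := (map_ofNat C 2).symm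
      rw [this, ← C_mul]; norm_num
    have e4 : (C (1 / 4) : MvPolynomial (Fin n) ℝ) = C (1 / 2) ^ 2 := by
      rw [← C_pow]; norm_num
    have eN : (C (N : ℝ) : MvPolynomial (Fin n) ℝ) = N := by simp
    constructor
    · convert h.add _ _ h1 (sq_mem h (X i + C (1 / 2))) using 1
      rw [C_add, e4, eN]
      linear_combination (-(X i)) * e
    · convert h.add _ _ h1 (sq_mem h (X i - C (1 / 2))) using 1
      rw [C_add, e4, eN]
      linear_combination (X i) * e
  intro a
  induction a using MvPolynomial.induction_on with
  | C a =>
    refine ⟨|a| + 1, by positivity, ?_, ?_⟩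
    · rw [← C_add]; exact const_mem h (by linarith [neg_abs_le a])
    · rw [← C_sub]; exact const_mem h (by linarith [le_abs_self a])
  | add p q hp hq =>
    obtain ⟨c, hc, hp⟩ := hp
    obtain ⟨d, hd, hq⟩ := hq
    exact ⟨c + d, by positivity, hp.add h hq⟩
  | mul_X p i hp =>
    obtain ⟨c, hc, hp⟩ := hp
    exact ⟨_, by positivity, hp.mul h hc (by positivity) (hX i)⟩

theorem arch_mono {T T' : Set (MvPolynomial (Fin n) ℝ)} (hT : Arch T) (hs : T ⊆ T') : Arch T' := by
  intro a
  obtain ⟨c, hc, h1, h2⟩ := hT a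
  exact ⟨c, hc, hs h1, hs h2⟩

theorem trick {T : Set (MvPolynomial (Fin n) ℝ)} (h : IsQM T) (hA : Arch T)
    {s f : MvPolynomial (Fin n) ℝ} (hs : IsSOS s) (hsf : s * f - 1 ∈ T) : f ∈ T := by
  obtain ⟨c, hc, -, h1⟩ := hA s
  obtain ⟨d, hd, -, h2⟩ := hA (s ^ 2 * f)
  obtain ⟨r, hr, h3, -⟩ := hA f
  set k : ℝ := c + d + 1 with hk
  have hkpos : 0 < k := by positivity
  have h1' : C (2 * k) - s ∈ T := by
    convert h.add _ _ h1 (const_mem h (c := 2 * k - c) (by linarith)) using 1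
    rw [C_sub]; ring
  have h2' : C (2 * k - 1) - s ^ 2 * f ∈ T := by
    convert h.add _ _ h2 (const_mem h (c := 2 * k - 1 - d) (by linarith)) using 1
    simp only [C_sub]; ring
  have step : ∀ ρ : ℝ, 0 ≤ ρ → C ρ + f ∈ T → C (ρ - 1 / k ^ 2) + f ∈ T := by
    intro ρ hρ hf
    have a1 := h.sq (C k - s) _ hf
    have a2 := smul_mem h (c := 2 * k) (by positivity) hsf
    have a3 := smul_mem h hρ (sos_mul h hs h1')
    have a4 := smul_mem h (c := 1 / k ^ 2) (by positivity)
      (h.add _ _ (h.add _ _ (h.add _ _ a1 a2) h2') a3)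
    convert a4 using 1
    have e : (C (1 / k ^ 2) * C k ^ 2 : MvPolynomial (Fin n) ℝ) = 1 := by
      rw [← C_pow, ← C_mul, one_div_mul_cancel (by positivity), C_1]
    simp only [C_sub, C_mul, C_1, show (C (2:ℝ) : MvPolynomial (Fin n) ℝ) = 2 from map_ofNat _ 2]
    linear_combination (-(C ρ + f)) * e
  have key : ∀ m : ℕ, C (max (r - m * (1 / k ^ 2)) 0) + f ∈ T := by
    intro m
    induction m with
    | zero => simpa [max_eq_left hr.le] using h3
    | succ m ih =>
      have := step _ (le_max_right _ _) ih
      convert h.add _ _ (const_mem h (c := max (r - (m + 1 : ℕ) * (1 / k ^ 2)) 0 -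
        (max (r - m * (1 / k ^ 2)) 0 - 1 / k ^ 2)) ?_) this using 1
      · rw [C_sub]; ring
      · have : 0 < 1 / k ^ 2 := by positivity
        push_cast
        rcases max_cases (r - m * (1 / k ^ 2)) 0 with ⟨e, _⟩ | ⟨e, _⟩
        · rw [e]; linarith [le_max_left (r - (m + 1) * (1 / k ^ 2)) 0]
        · rw [e]; linarith [le_max_right (r - (m + 1) * (1 / k ^ 2)) 0]
  obtain ⟨m, hm⟩ := exists_nat_gt (r * k ^ 2)
  have := key m
  rw [max_eq_right] at this
  · simpa using this
  · have : r < m * (1 / k ^ 2) := by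
      rw [mul_one_div, lt_div_iff₀ (by positivity)]; exact hm
    linarith

theorem extend {T : Set (MvPolynomial (Fin n) ℝ)} (h : IsQM T) (hA : Arch T)
    {q : MvPolynomial (Fin n) ℝ} (hq : q ∉ T) :
    ∃ T', IsQM T' ∧ T ⊆ T' ∧ -q ∈ T' ∧ -1 ∉ T' := by
  refine ⟨{a | ∃ t s, t ∈ T ∧ IsSOS s ∧ a = t - s * q}, ⟨?_, ?_, ?_⟩, ?_, ?_, ?_⟩
  · exact ⟨1, 0, h.one, sos_zero, by simp⟩
  · rintro _ _ ⟨t, s, ht, hs, rfl⟩ ⟨t', s', ht', hs', rfl⟩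
    exact ⟨t + t', s + s', h.add _ _ ht ht', sos_add hs hs', by ring⟩
  · rintro a _ ⟨t, s, ht, hs, rfl⟩
    exact ⟨a ^ 2 * t, a ^ 2 * s, h.sq _ _ ht, sos_sq_mul a hs, by ring⟩
  · intro t ht
    exact ⟨t, 0, ht, sos_zero, by simp⟩
  · exact ⟨0, 1, zero_mem h, by simpa using sos_sq (1 : MvPolynomial (Fin n) ℝ), by simp⟩
  · rintro ⟨t, s, ht, hs, e⟩
    apply hq
    apply trick h hA hs
    convert ht using 1
    linear_combination e

theorem exists_total {T : Set (MvPolynomial (Fin n) ℝ)} (h : IsQM T) (hA : Arch T)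
    (h1 : -1 ∉ T) : ∃ N, IsQM N ∧ T ⊆ N ∧ -1 ∉ N ∧ ∀ a, a ∈ N ∨ -a ∈ N := by
  obtain ⟨N, hTN, hN⟩ := zorn_subset_nonempty
    {N : Set (MvPolynomial (Fin n) ℝ) | IsQM N ∧ -1 ∉ N} (by
      rintro c hc hch ⟨N₀, hN₀⟩
      refine ⟨⋃₀ c, ⟨⟨⟨N₀, hN₀, (hc hN₀).1.one⟩, ?_, ?_⟩, ?_⟩, fun s hs => Set.subset_sUnion_of_mem hs⟩
      · rintro a b ⟨U, hU, ha⟩ ⟨V, hV, hb⟩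
        rcases hch.total hU hV with hUV | hUV
        · exact ⟨V, hV, (hc hV).1.add _ _ (hUV ha) hb⟩
        · exact ⟨U, hU, (hc hU).1.add _ _ ha (hUV hb)⟩
      · rintro a b ⟨U, hU, hb⟩
        exact ⟨U, hU, (hc hU).1.sq _ _ hb⟩
      · rintro ⟨U, hU, hb⟩
        exact (hc hU).2 hb) T ⟨h, h1⟩
  refine ⟨N, hN.prop.1, hTN, hN.prop.2, fun a => ?_⟩
  by_contra! hcon
  obtain ⟨N', hN', hs, hq, hn⟩ := extend hN.prop.1 (arch_mono hA hTN) hcon.1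
  exact hcon.2 (hN.le_of_ge ⟨hN', hn⟩ hs hq)

theorem const_nonneg {N : Set (MvPolynomial (Fin n) ℝ)} (h : IsQM N) (h1 : -1 ∉ N) {c : ℝ}
    (hc : C c ∈ N) : 0 ≤ c := by
  by_contra! hlt
  apply h1
  have := smul_mem h (c := -1 / c) (div_nonneg_of_nonpos (by norm_num) hlt.le) hc
  rwa [← C_mul, div_mul_cancel₀ _ hlt.ne, C_neg, C_1] at this

theorem exists_value {N : Set (MvPolynomial (Fin n) ℝ)} (h : IsQM N) (hA : Arch N)
    (h1 : -1 ∉ N) (ht : ∀ a, a ∈ N ∨ -a ∈ N) (a : MvPolynomial (Fin n) ℝ) :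
    ∃ x : ℝ, ∀ ε > 0, Bd N ε (a - C x) := by
  obtain ⟨c, hc, hc1, hc2⟩ := hA a
  set S : Set ℝ := {r | a - C r ∈ N} with hS
  have hne : S.Nonempty := ⟨-c, by simpa [hS, add_comm] using hc1⟩
  have hbd : BddAbove S := by
    refine ⟨c, fun r hr => ?_⟩
    have := h.add _ _ hc2 hr
    have := const_nonneg h h1 (c := c - r) (by convert this using 1; rw [C_sub]; ring)
    linarith
  refine ⟨sSup S, fun ε hε => ⟨?_, ?_⟩⟩
  · obtain ⟨r, hr, hlt⟩ := exists_lt_of_lt_csSup hne (sub_lt_self (sSup S) hε)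
    convert h.add _ _ hr (const_mem h (c := ε - sSup S + r) (by linarith)) using 1
    simp only [C_add, C_sub]; ring
  · have hno : sSup S + ε ∉ S := fun hm => by linarith [le_csSup hbd hm]
    have := (ht (a - C (sSup S + ε))).resolve_left hno
    convert this using 1
    simp only [C_add]; ring

theorem exists_point {N : Set (MvPolynomial (Fin n) ℝ)} (h : IsQM N) (hA : Arch N)
    (h1 : -1 ∉ N) (ht : ∀ a, a ∈ N ∨ -a ∈ N) :
    ∃ x : Fin n → ℝ, ∀ p ∈ N, 0 ≤ eval x p := by
  choose x hx using fun i : Fin n => exists_value h hA h1 ht (X i)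
  have hsc : ∀ (r : ℝ) (b : MvPolynomial (Fin n) ℝ), (∀ ε > 0, Bd N ε b) →
      ∀ ε > 0, Bd N ε (C r * b) := by
    intro r b hb ε hε
    have h2 := (hb (ε / (|r| + 1)) (by positivity)).smul h (r := r)
    have h3 : Bd N (ε / (|r| + 1)) (0 : MvPolynomial (Fin n) ℝ) :=
      ⟨by simpa using const_mem h (by positivity), by simpa using const_mem h (by positivity)⟩
    convert h2.add h h3 using 1
    · field_simp
    · simp
  have hadd : ∀ (a b : MvPolynomial (Fin n) ℝ), (∀ ε > 0, Bd N ε a) → (∀ ε > 0, Bd N ε b) →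
      ∀ ε > 0, Bd N ε (a + b) := by
    intro a b ha hb ε hε
    convert (ha (ε / 2) (by positivity)).add h (hb (ε / 2) (by positivity)) using 1
    ring
  have hmul : ∀ (a b : MvPolynomial (Fin n) ℝ), (∀ ε > 0, Bd N ε a) → (∀ ε > 0, Bd N ε b) →
      ∀ ε > 0, Bd N ε (a * b) := by
    intro a b ha hb ε hε
    have hp : 0 < Real.sqrt (ε / 2) := Real.sqrt_pos.2 (by positivity)
    convert (ha _ hp).mul h hp hp (hb _ hp) using 1
    rw [← two_mul, mul_pow, Real.sq_sqrt (by positivity)]; ring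
  have key : ∀ p : MvPolynomial (Fin n) ℝ, ∀ ε > 0, Bd N ε (p - C (eval x p)) := by
    intro p
    induction p using MvPolynomial.induction_on with
    | C a =>
      intro ε hε
      simp only [eval_C, sub_self]
      exact ⟨by simpa using const_mem h hε.le, by simpa using const_mem h hε.le⟩
    | add p q hp hq =>
      convert hadd _ _ hp hq using 4
      simp only [map_add]; ring
    | mul_X p i hp =>
      convert hadd _ _ (hmul _ _ hp (hx i))
        (hadd _ _ (hsc (eval x p) _ (hx i)) (hsc (x i) _ hp)) using 4
      simp only [map_mul, eval_X]; ring
  refine ⟨x, fun p hp => le_of_forall_pos_le_add fun ε hε => ?_⟩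
  have := h.add _ _ (key p ε hε).2 hp
  exact const_nonneg h h1 (by convert this using 1; rw [C_add]; ring)

theorem qm_isQM {r s : ℕ} (f : Fin r → MvPolynomial (Fin n) ℝ)
    (g : Fin s → MvPolynomial (Fin n) ℝ) : IsQM {q | InQuadraticModule f g q} := by
  refine ⟨?_, ?_, ?_⟩
  · exact ⟨1, 0, 0, by simpa using sos_sq (1 : MvPolynomial (Fin n) ℝ), fun _ => sos_zero, by simp⟩
  · rintro _ _ ⟨a, b, c, ha, hb, rfl⟩ ⟨a', b', c', ha', hb', rfl⟩
    refine ⟨a + a', b + b', c + c', sos_add ha ha', fun i => sos_add (hb i) (hb' i), ?_⟩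
    simp only [Pi.add_apply, add_mul, Finset.sum_add_distrib]; ring
  · rintro u _ ⟨a, b, c, ha, hb, rfl⟩
    refine ⟨u ^ 2 * a, fun i => u ^ 2 * b i, fun j => u ^ 2 * c j, sos_sq_mul u ha,
      fun i => sos_sq_mul u (hb i), ?_⟩
    simp only [mul_add, Finset.mul_sum, mul_assoc]

theorem f_mem {r s : ℕ} (f : Fin r → MvPolynomial (Fin n) ℝ)
    (g : Fin s → MvPolynomial (Fin n) ℝ) (i : Fin r) : InQuadraticModule f g (f i) := by
  refine ⟨0, fun k => if k = i then 1 else 0, 0, sos_zero, fun k => ?_, by simp⟩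
  dsimp only
  split_ifs
  · simpa using sos_sq (1 : MvPolynomial (Fin n) ℝ)
  · exact sos_zero

theorem g_mem {r s : ℕ} (f : Fin r → MvPolynomial (Fin n) ℝ)
    (g : Fin s → MvPolynomial (Fin n) ℝ) (j : Fin s) (u : MvPolynomial (Fin n) ℝ) :
    InQuadraticModule f g (u * g j) :=
  ⟨0, 0, fun k => if k = j then u else 0, sos_zero, fun k => sos_zero, by simp⟩

end PutinarAux

/-- Putinar's Positivstellensatz: if the quadratic module `M_S` is Archimedean
and `q > 0` on `K = {x : fᵢ(x) ≥ 0, gⱼ(x) = 0}`, then `q ∈ M_S`. -/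
theorem putinar_positivstellensatz {n r s : ℕ}
    (f : Fin r → MvPolynomial (Fin n) ℝ) (g : Fin s → MvPolynomial (Fin n) ℝ)
    (q : MvPolynomial (Fin n) ℝ)
    (hArch : ∃ N : ℕ, 1 ≤ N ∧
      InQuadraticModule f g ((N : MvPolynomial (Fin n) ℝ) - ∑ i, (MvPolynomial.X i) ^ 2))
    (hpos : ∀ x : Fin n → ℝ,
      ((∀ i : Fin r, 0 ≤ MvPolynomial.eval x (f i)) ∧
        (∀ j : Fin s, MvPolynomial.eval x (g j) = 0)) →
      0 < MvPolynomial.eval x q) :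
    InQuadraticModule f g q := by
  by_contra hq
  obtain ⟨N, -, hN⟩ := hArch
  have h := PutinarAux.qm_isQM f g
  have hA := PutinarAux.arch_of h hN
  obtain ⟨T, hT, hsub, hqT, hT1⟩ := PutinarAux.extend h hA hq
  obtain ⟨P, hP, hTP, hP1, htot⟩ := PutinarAux.exists_total hT (PutinarAux.arch_mono hA hsub) hT1
  obtain ⟨x, hx⟩ := PutinarAux.exists_point hP
    (PutinarAux.arch_mono hA (hsub.trans hTP)) hP1 htot
  have h0 := hpos x ⟨fun i => hx _ (hTP (hsub (PutinarAux.f_mem f g i))), fun j => by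
    have h1 := hx _ (hTP (hsub (PutinarAux.g_mem f g j 1)))
    have h2 := hx _ (hTP (hsub (PutinarAux.g_mem f g j (-1))))
    simp at h1 h2
    linarith⟩
  have h3 := hx _ (hTP hqT)
  simp at h3
  linarith
end

section
/- Let T ⊆ ℝ[x₁,…,xₙ] be a generating preprime (T is closed under addition and multiplication, contains the nonnegative real constants, and T − T = ℝ[x₁,…,xₙ]), and let M ⊆ ℝ[x₁,…,xₙ] be a T-module (1 ∈ M, M + M ⊆ M, and T·M ⊆ M) that is Archimedean, i.e. for every p ∈ ℝ[x₁,…,xₙ] there exists an integer N ≥ 1 with N − p ∈ M. Let K = {x ∈ ℝⁿ : q(x) ≥ 0 for all q ∈ M} be the nonnegativity set of M. Then −1 ∈ M if and only if K = ∅. -/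
open MvPolynomial in
theorem jacobi_aux {n : ℕ}
    (T M : Set (MvPolynomial (Fin n) ℝ))
    (hT_add : ∀ p q, p ∈ T → q ∈ T → p + q ∈ T)
    (hT_mul : ∀ p q, p ∈ T → q ∈ T → p * q ∈ T)
    (hT_const : ∀ c : ℝ, 0 ≤ c → (C c : MvPolynomial (Fin n) ℝ) ∈ T)
    (hT_gen : ∀ p : MvPolynomial (Fin n) ℝ, ∃ t₁ t₂, t₁ ∈ T ∧ t₂ ∈ T ∧ p = t₁ - t₂)
    (hM_one : (1 : MvPolynomial (Fin n) ℝ) ∈ M)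
    (hM_add : ∀ p q, p ∈ M → q ∈ M → p + q ∈ M)
    (hM_smul : ∀ t p, t ∈ T → p ∈ M → t * p ∈ M)
    (hArch : ∀ p : MvPolynomial (Fin n) ℝ, ∃ N : ℕ, 1 ≤ N ∧
      (N : MvPolynomial (Fin n) ℝ) - p ∈ M)
    (hneg : (-1 : MvPolynomial (Fin n) ℝ) ∉ M)
    (hmax : ∀ f, f ∉ M → ∃ q ∈ M, ∃ s ∈ T, -1 = q + s * f) :
    ∃ x : Fin n → ℝ, ∀ q ∈ M, 0 ≤ eval x q := by
  have hTM : ∀ t ∈ T, t ∈ M := fun t ht => by simpa using hM_smul t 1 ht hM_one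
  have hCM : ∀ c : ℝ, 0 ≤ c → (C c : MvPolynomial (Fin n) ℝ) ∈ M :=
    fun c hc => hTM _ (hT_const c hc)
  have hCneg : ∀ c : ℝ, c < 0 → (C c : MvPolynomial (Fin n) ℝ) ∉ M := by
    intro c hc h
    apply hneg
    have := hM_smul (C (-c⁻¹)) _ (hT_const (-c⁻¹) (by
      have := inv_lt_zero.2 hc
      linarith)) h
    rw [← C_mul, neg_mul, inv_mul_cancel₀ hc.ne, C_neg, C_1] at this
    exact this
  have hsupp : ∀ f g, f ∈ M → -f ∈ M → g * f ∈ M := by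
    intro f g h1 h2
    obtain ⟨t1, t2, ht1, ht2, rfl⟩ := hT_gen g
    have := hM_add _ _ (hM_smul t1 f ht1 h1) (hM_smul t2 (-f) ht2 h2)
    convert this using 1
    ring
  have htot : ∀ f, f ∉ M → -f ∈ M := by
    intro f hf
    by_contra hf'
    obtain ⟨q1, hq1, s1, hs1, e1⟩ := hmax f hf
    obtain ⟨q2, hq2, s2, hs2, e2⟩ := hmax (-f) hf'
    have hs : -s1 ∈ M := by
      have := hM_add _ _ (hM_add _ _ (hTM _ hs2) (hM_smul s1 q2 hs1 hq2)) (hM_smul s2 q1 hs2 hq1)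
      convert this using 1
      linear_combination s2 * e1 + s1 * e2
    have h3 := hsupp s1 f (hTM _ hs1) hs
    apply hneg
    rw [e1]
    exact hM_add _ _ hq1 (by rwa [mul_comm])
  have hArchR : ∀ p : MvPolynomial (Fin n) ℝ, ∃ K : ℝ, 0 < K ∧ C K - p ∈ M := by
    intro p
    obtain ⟨N, hN, h⟩ := hArch p
    refine ⟨N, by exact_mod_cast hN, ?_⟩
    simpa using h
  let J : Set (MvPolynomial (Fin n) ℝ) :=
    {p | ∀ e : ℝ, 0 < e → C e - p ∈ M ∧ C e + p ∈ M}
  have hJadd : ∀ p q, p ∈ J → q ∈ J → p + q ∈ J := by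
    intro p q hp hq e he
    obtain ⟨a, b⟩ := hp (e/2) (by linarith)
    obtain ⟨c, d⟩ := hq (e/2) (by linarith)
    have hh : (C e : MvPolynomial (Fin n) ℝ) = C (e/2) + C (e/2) := by
      rw [← C_add]; congr 1; ring
    constructor
    · convert hM_add _ _ a c using 1
      rw [hh]; ring
    · convert hM_add _ _ b d using 1
      rw [hh]; ring
  have hJneg : ∀ p, p ∈ J → -p ∈ J := by
    intro p hp e he
    obtain ⟨a, b⟩ := hp e he
    exact ⟨by simpa using b, by simpa [sub_eq_add_neg] using a⟩
  have hJT : ∀ t p, t ∈ T → p ∈ J → t * p ∈ J := by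
    intro t p ht hp e he
    obtain ⟨K, hK, hKt⟩ := hArchR t
    obtain ⟨a, b⟩ := hp (e/K) (by positivity)
    have h1 := hM_smul _ _ (hT_const (e/K) (by positivity)) hKt
    have hh : (C e : MvPolynomial (Fin n) ℝ) = C (e/K) * C K := by
      rw [← C_mul, div_mul_cancel₀ _ hK.ne']
    constructor
    · convert hM_add _ _ h1 (hM_smul t _ ht a) using 1
      rw [hh]; ring
    · convert hM_add _ _ h1 (hM_smul t _ ht b) using 1
      rw [hh]; ring
  have hJmul : ∀ g p, p ∈ J → g * p ∈ J := by
    intro g p hp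
    obtain ⟨t1, t2, ht1, ht2, rfl⟩ := hT_gen g
    convert hJadd _ _ (hJT t1 p ht1 hp) (hJneg _ (hJT t2 p ht2 hp)) using 1
    ring
  have hval : ∀ f, ∃ r : ℝ, f - C r ∈ J := by
    intro f
    let S : Set ℝ := {r | f - C r ∈ M}
    have hne : S.Nonempty := by
      obtain ⟨K, hK, h⟩ := hArchR (-f)
      refine ⟨-K, ?_⟩
      change f - C (-K) ∈ M
      convert h using 1
      rw [C_neg]; ring
    have hbdd : BddAbove S := by
      obtain ⟨K, hK, h⟩ := hArchR f
      refine ⟨K, fun r hr => ?_⟩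
      by_contra hlt
      push Not at hlt
      apply hCneg (K - r) (by linarith)
      convert hM_add _ _ h hr using 1
      rw [C_sub]; ring
    refine ⟨sSup S, fun e he => ⟨?_, ?_⟩⟩
    · have : f - C (sSup S + e) ∉ M := by
        intro h
        have := le_csSup hbdd (show sSup S + e ∈ S from h)
        linarith
      convert htot _ this using 1
      rw [C_add]; ring
    · obtain ⟨r, hr, hlt⟩ := exists_lt_of_lt_csSup hne (show sSup S - e < sSup S by linarith)
      convert hM_add _ _ hr (hCM (r - (sSup S - e)) (by linarith)) using 1
      rw [C_sub, C_sub]; ring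
  choose a ha using fun i => hval (X i)
  have hev : ∀ p : MvPolynomial (Fin n) ℝ, p - C (eval a p) ∈ J := by
    intro p
    induction p using MvPolynomial.induction_on with
    | C c =>
      intro e he
      simpa using hCM e he.le
    | add p q hp hq =>
      convert hJadd _ _ hp hq using 1
      rw [map_add, C_add]; ring
    | mul_X p i hp =>
      convert hJadd _ _ (hJmul (X i) _ hp) (hJmul (C (eval a p)) _ (ha i)) using 1
      rw [map_mul, eval_X, C_mul]; ring
  refine ⟨a, fun q hq => ?_⟩
  by_contra hlt
  push Not at hlt
  apply hCneg (-(eval a q)/2 + eval a q) (by linarith)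
  convert hM_add _ _ hq (hev q (-(eval a q)/2) (by linarith)).1 using 1
  rw [C_add]; ring

/-- Jacobi's representation corollary: let `T ⊆ ℝ[x]` be a generating preprime
and `M` an Archimedean `T`-module. Then `-1 ∈ M` iff the nonnegativity set
`K = {x : q(x) ≥ 0 for all q ∈ M}` is empty. -/
theorem jacobi_representation {n : ℕ}
    (T M : Set (MvPolynomial (Fin n) ℝ))
    -- `T` is a generating preprime:
    (hT_add : ∀ p q, p ∈ T → q ∈ T → p + q ∈ T)
    (hT_mul : ∀ p q, p ∈ T → q ∈ T → p * q ∈ T)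
    (hT_const : ∀ c : ℝ, 0 ≤ c → (MvPolynomial.C c : MvPolynomial (Fin n) ℝ) ∈ T)
    (hT_gen : ∀ p : MvPolynomial (Fin n) ℝ, ∃ t₁ t₂, t₁ ∈ T ∧ t₂ ∈ T ∧ p = t₁ - t₂)
    -- `M` is a `T`-module:
    (hM_one : (1 : MvPolynomial (Fin n) ℝ) ∈ M)
    (hM_add : ∀ p q, p ∈ M → q ∈ M → p + q ∈ M)
    (hM_smul : ∀ t p, t ∈ T → p ∈ M → t * p ∈ M)
    -- `M` is Archimedean:
    (hArch : ∀ p : MvPolynomial (Fin n) ℝ, ∃ N : ℕ, 1 ≤ N ∧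
      (N : MvPolynomial (Fin n) ℝ) - p ∈ M) :
    (-1 : MvPolynomial (Fin n) ℝ) ∈ M ↔
      ¬ ∃ x : Fin n → ℝ, ∀ q ∈ M, 0 ≤ MvPolynomial.eval x q := by
  constructor
  · rintro h ⟨x, hx⟩
    have := hx _ h
    rw [map_neg, map_one] at this
    linarith
  · intro hno
    by_contra hneg
    apply hno
    let Z : Set (Set (MvPolynomial (Fin n) ℝ)) :=
      {Q | (∀ p q, p ∈ Q → q ∈ Q → p + q ∈ Q) ∧ (∀ t p, t ∈ T → p ∈ Q → t * p ∈ Q) ∧ -1 ∉ Q}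
    obtain ⟨Q, hMQ, hQ⟩ := zorn_subset_nonempty Z (by
      intro c hc hchain hne
      refine ⟨⋃₀ c, ⟨?_, ?_, ?_⟩, fun s hs => Set.subset_sUnion_of_mem hs⟩
      · rintro p q ⟨A, hA, hp⟩ ⟨B, hB, hq⟩
        rcases hchain.total hA hB with h | h
        · exact ⟨B, hB, (hc hB).1 p q (h hp) hq⟩
        · exact ⟨A, hA, (hc hA).1 p q hp (h hq)⟩
      · rintro t p ht ⟨A, hA, hp⟩
        exact ⟨A, hA, (hc hA).2.1 t p ht hp⟩
      · rintro ⟨A, hA, hp⟩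
        exact (hc hA).2.2 hp) M ⟨hM_add, hM_smul, hneg⟩
    obtain ⟨hQadd, hQsmul, hQneg⟩ := hQ.prop
    have h0T : (0 : MvPolynomial (Fin n) ℝ) ∈ T := by simpa using hT_const 0 le_rfl
    have h1T : (1 : MvPolynomial (Fin n) ℝ) ∈ T := by simpa using hT_const 1 zero_le_one
    have h0Q : (0 : MvPolynomial (Fin n) ℝ) ∈ Q := by
      simpa using hQsmul 0 1 h0T (hMQ hM_one)
    obtain ⟨x, hx⟩ := jacobi_aux T Q hT_add hT_mul hT_const hT_gen (hMQ hM_one) hQadd hQsmul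
      (fun p => by
        obtain ⟨N, h1, h2⟩ := hArch p
        exact ⟨N, h1, hMQ h2⟩) hQneg (by
      intro f hf
      by_contra hcon
      apply hf
      let Q' : Set (MvPolynomial (Fin n) ℝ) := {g | ∃ q ∈ Q, ∃ s ∈ T, g = q + s * f}
      have hQ' : Q' ∈ Z := by
        refine ⟨?_, ?_, hcon⟩
        · rintro _ _ ⟨q, hq, s, hs, rfl⟩ ⟨q', hq', s', hs', rfl⟩
          exact ⟨q + q', hQadd _ _ hq hq', s + s', hT_add _ _ hs hs', by ring⟩
        · rintro t _ ht ⟨q, hq, s, hs, rfl⟩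
          exact ⟨t * q, hQsmul _ _ ht hq, t * s, hT_mul _ _ ht hs, by ring⟩
      have hle : Q ≤ Q' := fun q hq => ⟨q, hq, 0, h0T, by ring⟩
      exact hQ.le_of_ge hQ' hle ⟨0, h0Q, 1, h1T, by ring⟩)
    exact ⟨x, fun q hq => hx q (hMQ hq)⟩
end
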